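/- Let C ⊆ ℂ. Then C is disconnected (as a subspace of ℂ) if and only if there is a closed connected set A ⊆ ℂ that disconnects C, i.e. A ∩ C = ∅ and at least two distinct connected components of ℂ \ A intersect C. -/

import Mathlib

open Filter Set

/-- `A` disconnects `C` if `A ∩ C = ∅` and at least two distinct connected components
of `ℂ \ A` intersect `C`. -/
def Disconnects (A C : Set ℂ) : Prop :=
  A ∩ C = ∅ ∧ ∃ z ∈ C, ∃ w ∈ C, connectedComponentIn Aᶜ z ≠ connectedComponentIn Aᶜ w

section LocallyConnected

variable {X : Type*} [TopologicalSpace X] [LocallyConnectedSpace X]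

theorem closure_connectedComponentIn_inter_subset {U : Set X} (hU : IsOpen U) (x : X) :
    closure (connectedComponentIn U x) ∩ U ⊆ connectedComponentIn U x := by
  rintro y ⟨hy, hyU⟩
  obtain ⟨t, hty, htx⟩ := mem_closure_iff.1 hy _ (hU.connectedComponentIn (x := y))
    (mem_connectedComponentIn hyU)
  rw [connectedComponentIn_eq htx, ← connectedComponentIn_eq hty]
  exact mem_connectedComponentIn hyU

theorem frontier_connectedComponentIn_subset_compl {U : Set X} (hU : IsOpen U) (x : X) :
    frontier (connectedComponentIn U x) ⊆ Uᶜ := by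
  intro y hy hyU
  rw [hU.connectedComponentIn.frontier_eq] at hy
  exact hy.2 (closure_connectedComponentIn_inter_subset hU x ⟨hy.1, hyU⟩)

/-- In a connected, locally connected space, the complement of a component of the complement of
a closed connected set is connected. -/
theorem IsConnected.isPreconnected_compl_connectedComponentIn_compl [PreconnectedSpace X]
    {D : Set X} (hD : IsConnected D) (hDc : IsClosed D) (w : X) :
    IsPreconnected (connectedComponentIn Dᶜ w)ᶜ := by
  set W := connectedComponentIn Dᶜ w with hW
  have hDW : D ⊆ Wᶜ := fun x hx hxW => connectedComponentIn_subset _ _ hxW hx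
  have hWc : IsClosed Wᶜ := (hDc.isOpen_compl.connectedComponentIn).isClosed_compl
  have key : ∀ P Q : Set X, IsClosed P → IsClosed Q → Wᶜ ⊆ P ∪ Q → Disjoint P Q → D ⊆ P →
      Wᶜ ⊆ P := by
    intro P Q hP hQ hPQ hdisj hDP
    have hopen : IsOpen (Wᶜ ∩ Q) := by
      refine isOpen_iff_mem_nhds.2 fun q hq => ?_
      have hqP : q ∈ Pᶜ := fun h => hdisj.le_bot ⟨h, hq.2⟩
      refine mem_of_superset
        (hP.isOpen_compl.connectedComponentIn.mem_nhds (mem_connectedComponentIn hqP)) ?_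
      intro y hy
      have hyD : connectedComponentIn Pᶜ q ⊆ Dᶜ :=
        (connectedComponentIn_subset _ _).trans (compl_subset_compl.2 hDP)
      have hyW : y ∈ Wᶜ := by
        intro hyW
        apply hq.1
        rw [hW, connectedComponentIn_eq hyW]
        exact isPreconnected_connectedComponentIn.subset_connectedComponentIn hy hyD
          (mem_connectedComponentIn hqP)
      exact ⟨hyW, (hPQ hyW).resolve_left (connectedComponentIn_subset _ _ hy)⟩
    have hempty : Wᶜ ∩ Q = ∅ := by
      refine (isClopen_iff.1 ⟨hWc.inter hQ, hopen⟩).resolve_right fun h => ?_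
      obtain ⟨d, hd⟩ := hD.nonempty
      have hdQ : d ∈ Wᶜ ∩ Q := h ▸ mem_univ d
      exact hdisj.le_bot ⟨hDP hd, hdQ.2⟩
    exact fun y hy => (hPQ hy).resolve_right fun hyQ => hempty.le ⟨hy, hyQ⟩
  refine (isPreconnected_iff_subset_of_fully_disjoint_closed hWc).2
    fun P Q hP hQ hPQ hdisj => ?_
  rcases (isPreconnected_iff_subset_of_fully_disjoint_closed hDc).1 hD.isPreconnected P Q hP hQ
    (hDW.trans hPQ) hdisj with h | h
  · exact .inl (key P Q hP hQ hPQ hdisj h)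
  · exact .inr (key Q P hQ hP (union_comm P Q ▸ hPQ) hdisj.symm h)

end LocallyConnected

theorem IsPreconnected.sub_const_of_circle_exp_eq {X : Type*} [TopologicalSpace X] {S : Set X}
    (hS : IsPreconnected S) {f g : X → ℝ} (hf : Continuous f) (hg : Continuous g)
    (h : ∀ x ∈ S, Circle.exp (f x) = Circle.exp (g x)) {p q : X} (hp : p ∈ S) (hq : q ∈ S) :
    f p - g p = f q - g q := by
  have hd : DiscreteTopology (AddSubgroup.zmultiples (2 * Real.pi) : Set ℝ) :=
    inferInstanceAs (DiscreteTopology (AddSubgroup.zmultiples (2 * Real.pi)))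
  refine hS.constant_of_mapsTo (T := (AddSubgroup.zmultiples (2 * Real.pi) : Set ℝ))
    (f := fun x => f x - g x) ⟨hd⟩ (hf.sub hg).continuousOn (fun x hx => ?_) hp hq
  obtain ⟨m, hm⟩ := Circle.exp_eq_exp.1 (h x hx)
  exact AddSubgroup.mem_zmultiples_iff.2 ⟨m, by simp [hm]⟩

/-- Simply connected, locally path-connected normal spaces are unicoherent. -/
theorem IsPreconnected.inter_of_union_eq_univ {X : Type*} [TopologicalSpace X]
    [SimplyConnectedSpace X] [LocallyPathConnectedSpace X] [NormalSpace X] {S T : Set X}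
    (hS : IsPreconnected S) (hT : IsPreconnected T) (hSc : IsClosed S) (hTc : IsClosed T)
    (hST : S ∪ T = univ) : IsPreconnected (S ∩ T) := by
  classical
  refine (isPreconnected_iff_subset_of_fully_disjoint_closed (hSc.inter hTc)).2
    fun P Q hP hQ hPQ hdisj => ?_
  by_contra! hcon
  obtain ⟨q, hq, hqP⟩ := not_subset.1 hcon.1
  obtain ⟨p, hp, hpQ⟩ := not_subset.1 hcon.2
  replace hqP := (hPQ hq).resolve_left hqP
  replace hpQ := (hPQ hp).resolve_right hpQ
  obtain ⟨u, hu0, hu1, -⟩ := exists_continuous_zero_one_of_isClosed hP hQ hdisj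
  have hf : Continuous fun x => Real.pi * u x := by fun_prop
  have hg : Continuous fun x => -(Real.pi * u x) := by fun_prop
  have hagree : ∀ x ∈ S ∩ T, Circle.exp (Real.pi * u x) = Circle.exp (-(Real.pi * u x)) := by
    intro x hx
    rcases hPQ hx with h | h
    · simp [hu0 h]
    · refine Circle.exp_eq_exp.2 ⟨1, ?_⟩
      simp [hu1 h]
      ring
  have hfront : ∀ x ∈ frontier S, x ∈ S ∩ T := by
    intro x hx
    refine ⟨hSc.frontier_subset hx, ?_⟩
    rw [frontier_eq_closure_inter_closure] at hx
    exact closure_minimal (fun y hy => (hST.ge (mem_univ y)).resolve_left hy) hTc hx.2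
  obtain ⟨F, hF⟩ : ∃ F : C(X, Circle), ⇑F = S.piecewise (fun x => Circle.exp (Real.pi * u x))
      (fun x => Circle.exp (-(Real.pi * u x))) :=
    ⟨⟨_, Continuous.piecewise (fun x hx => hagree x (hfront x hx))
      (Circle.exp.continuous.comp hf) (Circle.exp.continuous.comp hg)⟩, rfl⟩
  have hFS : ∀ x ∈ S, F x = Circle.exp (Real.pi * u x) := fun x hx => by
    rw [hF, piecewise_eq_of_mem _ _ _ hx]
  have hFT : ∀ x ∈ T, F x = Circle.exp (-(Real.pi * u x)) := by
    intro x hx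
    by_cases hxS : x ∈ S
    · rw [hFS x hxS, hagree x ⟨hxS, hx⟩]
    · rw [hF, piecewise_eq_of_notMem _ _ _ hxS]
  obtain ⟨θ, ⟨-, hθ⟩, -⟩ := Circle.isCoveringMap_exp.existsUnique_continuousMap_lifts F p
    (Real.pi * u p) (hFS p hp.1).symm
  have hθF : ∀ x, Circle.exp (θ x) = F x := fun x => congrFun hθ x
  have h1 := hS.sub_const_of_circle_exp_eq θ.continuous hf
    (fun x hx => (hθF x).trans (hFS x hx)) hp.1 hq.1
  have h2 := hT.sub_const_of_circle_exp_eq θ.continuous hg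
    (fun x hx => (hθF x).trans (hFT x hx)) hp.2 hq.2
  simp only [hu0 hpQ, hu1 hqP, Pi.zero_apply, Pi.one_apply] at h1 h2
  linarith [Real.pi_pos]

theorem separatedNhds_of_not_isPreconnected {X : Type*} [TopologicalSpace X]
    [CompletelyNormalSpace X] {C : Set X} (hC : ¬ IsPreconnected C) :
    ∃ U V : Set X, IsOpen U ∧ IsOpen V ∧ Disjoint U V ∧ C ⊆ U ∪ V ∧
      (C ∩ U).Nonempty ∧ (C ∩ V).Nonempty := by
  simp only [IsPreconnected, not_forall] at hC
  obtain ⟨u, v, hu, hv, huv, ⟨z, hz⟩, ⟨w, hw⟩, hne⟩ := hC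
  have hdisj : ∀ x ∈ C, x ∈ u → x ∉ v := fun x hx hxu hxv => hne ⟨x, hx, hxu, hxv⟩
  have h1 : Disjoint (closure (C ∩ u)) (C ∩ v) := by
    refine disjoint_left.2 fun x hx hxv => ?_
    obtain ⟨y, hyv, hy⟩ := mem_closure_iff.1 hx v hv hxv.2
    exact hdisj y hy.1 hy.2 hyv
  have h2 : Disjoint (C ∩ u) (closure (C ∩ v)) := by
    refine disjoint_right.2 fun x hx hxu => ?_
    obtain ⟨y, hyu, hy⟩ := mem_closure_iff.1 hx u hu hxu.2
    exact hdisj y hy.1 hyu hy.2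
  obtain ⟨U, V, hU, hV, hCU, hCV, hUV⟩ :=
    separatedNhds_iff_disjoint.2 (completely_normal h1 h2)
  refine ⟨U, V, hU, hV, hUV, fun x hx => ?_, ⟨z, hz.1, hCU hz⟩, ⟨w, hw.1, hCV hw⟩⟩
  exact (huv hx).imp (fun h => hCU ⟨hx, h⟩) (fun h => hCV ⟨hx, h⟩)

/-- A closed connected set separating a point of `U` from a point of `V`, inside the complement
of the disjoint open sets `U` and `V`. -/
theorem exists_isClosed_isConnected_separating {X : Type*} [TopologicalSpace X]
    [SimplyConnectedSpace X] [LocallyPathConnectedSpace X] [NormalSpace X] {U V : Set X}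
    (hU : IsOpen U) (hV : IsOpen V) (hUV : Disjoint U V) {z w : X} (hz : z ∈ U) (hw : w ∈ V) :
    ∃ A : Set X, IsClosed A ∧ IsConnected A ∧ A ⊆ (U ∪ V)ᶜ ∧
      connectedComponentIn Aᶜ z ≠ connectedComponentIn Aᶜ w := by
  set U' := connectedComponentIn U z
  have hU'o : IsOpen U' := hU.connectedComponentIn
  have hzU' : z ∈ U' := mem_connectedComponentIn hz
  set D := closure U'
  have hDV : Disjoint D V :=
    (hUV.mono_left (connectedComponentIn_subset U z)).closure_left hV
  have hD : IsConnected D := (isConnected_connectedComponentIn_iff.2 hz).closure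
  have hDc : IsClosed D := isClosed_closure
  set W := connectedComponentIn Dᶜ w
  have hwD : w ∈ Dᶜ := fun h => hDV.le_bot ⟨h, hw⟩
  have hwW : w ∈ W := mem_connectedComponentIn hwD
  have hWo : IsOpen W := hDc.isOpen_compl.connectedComponentIn
  have hU'W : Disjoint U' W :=
    disjoint_left.2 fun x hx hxW => connectedComponentIn_subset _ _ hxW (subset_closure hx)
  have hfront : frontier W = closure W ∩ Wᶜ := by rw [hWo.frontier_eq, sdiff_eq]
  have hAD : frontier W ⊆ D := by
    simpa using frontier_connectedComponentIn_subset_compl hDc.isOpen_compl w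
  have hzW : z ∉ W := fun h => hU'W.le_bot ⟨hzU', h⟩
  have hAU' : Disjoint U' (frontier W) :=
    (hU'W.closure_right hU'o).mono_right frontier_subset_closure
  have hAUV : frontier W ⊆ (U ∪ V)ᶜ := by
    rintro x hx (hxU | hxV)
    · exact hAU'.le_bot ⟨closure_connectedComponentIn_inter_subset hU z ⟨hAD hx, hxU⟩, hx⟩
    · exact hDV.le_bot ⟨hAD hx, hxV⟩
  refine ⟨frontier W, isClosed_frontier, ⟨?_, ?_⟩, hAUV, ?_⟩
  · exact nonempty_frontier_iff.2 ⟨⟨w, hwW⟩, fun h => hzW (h ▸ mem_univ z)⟩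
  · rw [hfront]
    refine isPreconnected_connectedComponentIn.closure.inter_of_union_eq_univ
      (hD.isPreconnected_compl_connectedComponentIn_compl hDc w) isClosed_closure
      hWo.isClosed_compl (eq_univ_of_forall fun x => ?_)
    exact (em (x ∈ W)).imp (fun h => subset_closure h) id
  · intro heq
    have hzA : z ∈ (frontier W)ᶜ := fun h => hAUV h (.inl hz)
    have hwA : w ∈ (frontier W)ᶜ := fun h => hAUV h (.inr hw)
    have hsub : connectedComponentIn (frontier W)ᶜ w ⊆ W := by
      refine isPreconnected_connectedComponentIn.subset_left_of_subset_union hWo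
        isClosed_closure.isOpen_compl (disjoint_compl_right.mono_left subset_closure)
        (fun x hx => ?_) ⟨w, mem_connectedComponentIn hwA, hwW⟩
      by_contra! hxW
      rw [mem_union, not_or, notMem_compl_iff] at hxW
      exact connectedComponentIn_subset _ _ hx (hfront ▸ ⟨hxW.2, hxW.1⟩)
    exact hzW (hsub (heq ▸ mem_connectedComponentIn hzA))

/-- A set `C ⊆ ℂ` is disconnected if and only if some closed connected set `A ⊆ ℂ`
disconnects it. -/
theorem disconnected_iff_exists_closed_connected_disconnects (C : Set ℂ) :
    ¬ IsPreconnected C ↔ ∃ A : Set ℂ, IsClosed A ∧ IsConnected A ∧ Disconnects A C := by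
  constructor
  · intro hC
    obtain ⟨U, V, hU, hV, hUV, hCUV, ⟨z, hzC, hzU⟩, ⟨w, hwC, hwV⟩⟩ :=
      separatedNhds_of_not_isPreconnected hC
    obtain ⟨A, hAc, hA, hAUV, hne⟩ :=
      exists_isClosed_isConnected_separating hU hV hUV hzU hwV
    refine ⟨A, hAc, hA, ?_, z, hzC, w, hwC, hne⟩
    exact eq_empty_of_forall_notMem fun x hx => hAUV hx.1 (hCUV hx.2)
  · rintro ⟨A, -, -, hAC, z, hz, w, hw, hne⟩ hC
    have hCA : C ⊆ Aᶜ := fun x hx hxA => hAC.le ⟨hxA, hx⟩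
    exact hne (connectedComponentIn_eq (hC.subset_connectedComponentIn hz hCA hw))
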